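/- Let n be a positive natural number, let Σ denote the 2n×2n complex matrix given in block form by [[0, I],[I, 0]], and let W_B and W_C be n×2n complex matrices such that the 2n×2n matrix W := [W_B; W_C] (W_B stacked on top of W_C) is invertible. Then the following are equivalent: (i) for every z ∈ ℂ^{2n}, ⟨z, Σz⟩ = ⟨W_B z, W_C z⟩ + ⟨W_C z, W_B z⟩ (equivalently, z*Σz = 2·Re⟨W_B z, W_C z⟩); (ii) the 2n×2n block matrix [[W_B Σ W_B*, W_B Σ W_C*],[W_C Σ W_B*, W_C Σ W_C*]] equals [[0, I],[I, 0]], i.e., W Σ W* = Σ. -/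

import Mathlib

open Matrix

/-- Polarization: a complex matrix is determined by its quadratic form. -/
theorem Matrix.eq_of_forall_star_dotProduct_mulVec {m : Type*} [Fintype m] [DecidableEq m]
    {A B : Matrix m m ℂ} (h : ∀ z : m → ℂ, star z ⬝ᵥ A *ᵥ z = star z ⬝ᵥ B *ᵥ z) : A = B := by
  apply (Matrix.toEuclideanLin (𝕜 := ℂ)).injective
  rw [← ext_inner_map]
  intro x
  rw [← inner_conj_symm, ← inner_conj_symm (Matrix.toEuclideanLin B x)]
  congr 1
  simpa [EuclideanSpace.inner_eq_star_dotProduct, dotProduct_comm] using h x.ofLp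

/-- For an involutive `S`, the isometry conditions `Wᴴ S W = S` and `W S Wᴴ = S` agree. -/
theorem Matrix.conjTranspose_mul_mul_eq_iff {m : Type*} [Fintype m] [DecidableEq m]
    {S W : Matrix m m ℂ} (hS : S * S = 1) : Wᴴ * S * W = S ↔ W * S * Wᴴ = S := by
  constructor
  · intro h
    have h1 : W * (S * Wᴴ * S) = 1 := by
      rw [mul_eq_one_comm, Matrix.mul_assoc, Matrix.mul_assoc, ← Matrix.mul_assoc Wᴴ, h, hS]
    calc W * S * Wᴴ = W * (S * Wᴴ * S) * S := by simp only [Matrix.mul_assoc, hS, Matrix.mul_one]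
      _ = S := by rw [h1, Matrix.one_mul]
  · intro h
    have h1 : S * W * S * Wᴴ = 1 := by
      rw [Matrix.mul_assoc S, Matrix.mul_assoc S, h, hS]
    have h2 : Wᴴ * (S * W * S) = 1 := by rwa [mul_eq_one_comm]
    calc Wᴴ * S * W = Wᴴ * (S * W * S) * S := by simp only [Matrix.mul_assoc, hS, Matrix.mul_one]
      _ = S := by rw [h2, Matrix.one_mul]

/-- Matrix characterization of impedance energy preservation (Theorem 2.5 of the paper):
with `Σ = [[0,I],[I,0]]` and `W = [W_B; W_C]` invertible, the identity
`⟨z, Σ z⟩ = ⟨W_B z, W_C z⟩ + ⟨W_C z, W_B z⟩` for all `z` holds iff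
`[[W_B Σ W_B*, W_B Σ W_C*],[W_C Σ W_B*, W_C Σ W_C*]] = [[0,I],[I,0]]`. -/
theorem impedance_energy_preserving_matrix_characterization
    (n : ℕ) (hn : 0 < n)
    (W_B W_C : Matrix (Fin n) (Fin n ⊕ Fin n) ℂ)
    (hW : IsUnit (Matrix.fromRows W_B W_C))
    (S : Matrix (Fin n ⊕ Fin n) (Fin n ⊕ Fin n) ℂ)
    (hS : S = Matrix.fromBlocks 0 1 1 0) :
    (∀ z : (Fin n ⊕ Fin n) → ℂ,
        star z ⬝ᵥ S.mulVec z =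
          star (W_B.mulVec z) ⬝ᵥ W_C.mulVec z + star (W_C.mulVec z) ⬝ᵥ W_B.mulVec z) ↔
      Matrix.fromBlocks (W_B * S * W_Bᴴ) (W_B * S * W_Cᴴ)
          (W_C * S * W_Bᴴ) (W_C * S * W_Cᴴ) =
        Matrix.fromBlocks 0 1 1 0 := by
  have hSS : S * S = 1 := by
    rw [hS, fromBlocks_multiply]
    simp
  have hquad (z : Fin n ⊕ Fin n → ℂ) :
      star (W_B *ᵥ z) ⬝ᵥ W_C *ᵥ z + star (W_C *ᵥ z) ⬝ᵥ W_B *ᵥ z =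
        star z ⬝ᵥ ((fromRows W_B W_C)ᴴ * S * fromRows W_B W_C) *ᵥ z := by
    have hM : (fromRows W_B W_C)ᴴ * S * fromRows W_B W_C = W_Bᴴ * W_C + W_Cᴴ * W_B := by
      rw [hS, conjTranspose_fromRows_eq_fromCols_conjTranspose, fromCols_mul_fromBlocks,
        fromCols_mul_fromRows]
      simp [add_comm]
    rw [hM, add_mulVec, dotProduct_add, ← mulVec_mulVec, ← mulVec_mulVec,
      dotProduct_mulVec _ W_Bᴴ, dotProduct_mulVec _ W_Cᴴ, ← star_mulVec, ← star_mulVec]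
  have hblock : fromBlocks (W_B * S * W_Bᴴ) (W_B * S * W_Cᴴ) (W_C * S * W_Bᴴ) (W_C * S * W_Cᴴ) =
      fromRows W_B W_C * S * (fromRows W_B W_C)ᴴ := by
    rw [conjTranspose_fromRows_eq_fromCols_conjTranspose, fromRows_mul, fromRows_mul_fromCols]
  rw [hblock, ← hS, ← conjTranspose_mul_mul_eq_iff hSS]
  simp only [hquad]
  exact ⟨fun h => (eq_of_forall_star_dotProduct_mulVec h).symm, fun h z => by rw [h]⟩
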